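/- Let ε_n ∈ [0,1] be a sequence converging to 0, let k ∈ ℕ and ν ∈ {+,−}, and suppose (λ_n, u_n) ∈ ℝ × S_k^ν is, for each n, a nontrivial solution of the approximate problem (φ_p(u'))' + λ_n a(x) φ_p(u) + f(x, u|u|^{ε_n}, λ_n) + g(x,u,λ_n) = 0 on (0,1), u(0) = u(1) = 0. If (λ_n, u_n) converges to (λ, 0) in ℝ × E, then λ ∈ I_k = [λ_k − M/a_0, λ_k + M/a_0], where a_0 = min_{x∈[0,1]} a(x). -/

import Mathlib

open Set Filter Topology

/-- `φ_p(s) = |s|^{p-2} s`. -/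
noncomputable def phip (p s : ℝ) : ℝ := |s| ^ (p - 2) * s

/-- membership in the space `E = {u ∈ C¹[0,1] : u 0 = u 1 = 0}`. -/
def MemE (u : ℝ → ℝ) : Prop := ContDiff ℝ 1 u ∧ u 0 = 0 ∧ u 1 = 0

/-- `u` is nontrivial on `[0,1]`. -/
def Nontriv (u : ℝ → ℝ) : Prop := ∃ x ∈ Set.Icc (0:ℝ) 1, u x ≠ 0

/-- `u ∈ S_k^ν` (ν = 1 or -1): u ∈ E, exactly k-1 interior zeros in (0,1), all zeros of u in
[0,1] simple, and ν·u positive near 0. -/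
def MemS (k : ℕ) (ν : ℝ) (u : ℝ → ℝ) : Prop :=
  MemE u ∧
  {x ∈ Ioo (0:ℝ) 1 | u x = 0}.Finite ∧
  {x ∈ Ioo (0:ℝ) 1 | u x = 0}.ncard = k - 1 ∧
  (∀ x ∈ Icc (0:ℝ) 1, u x = 0 → deriv u x ≠ 0) ∧
  ∃ δ > 0, ∀ x ∈ Ioo (0:ℝ) δ, 0 < ν * u x

/-- the `C¹` norm `‖u‖ = max_{[0,1]} |u| + max_{[0,1]} |u'|` of `E`. -/
noncomputable def normE (u : ℝ → ℝ) : ℝ :=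
  (⨆ x : Icc (0:ℝ) 1, |u x|) + (⨆ x : Icc (0:ℝ) 1, |deriv u x|)

/-- `u` solves the linear eigenvalue problem `-(φ_p(u'))' = λ a φ_p(u)` on (0,1), u(0)=u(1)=0. -/
def IsLinSol (p : ℝ) (a : ℝ → ℝ) (lam : ℝ) (u : ℝ → ℝ) : Prop :=
  MemE u ∧ ∀ x ∈ Set.Ioo (0:ℝ) 1,
    HasDerivAt (fun y => phip p (deriv u y)) (-(lam * a x * phip p (u x))) x

/-- `u` solves the approximate problem
`(φ_p(u'))' + λ a φ_p(u) + f(x, u|u|^ε, λ) + g(x,u,λ) = 0` on (0,1), u(0)=u(1)=0. -/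
def IsSolEps (p : ℝ) (a : ℝ → ℝ) (f g : ℝ → ℝ → ℝ → ℝ) (ε lam : ℝ) (u : ℝ → ℝ) : Prop :=
  MemE u ∧ ∀ x ∈ Set.Ioo (0:ℝ) 1,
    HasDerivAt (fun y => phip p (deriv u y))
      (-(lam * a x * phip p (u x) + f x (u x * |u x| ^ ε) lam + g x (u x) lam)) x

lemma phip_neg (p s : ℝ) : phip p (-s) = -phip p s := by
  simp [phip]

lemma phip_of_pos {s : ℝ} (p : ℝ) (hs : 0 < s) : phip p s = s ^ (p - 1) := by
  rw [phip, abs_of_pos hs, show p - 1 = p - 2 + 1 by ring, Real.rpow_add_one hs.ne']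

lemma abs_phip {s : ℝ} (p : ℝ) (hs : s ≠ 0) : |phip p s| = |s| ^ (p - 1) := by
  rw [phip, abs_mul, abs_of_nonneg (Real.rpow_nonneg (abs_nonneg s) _),
    show p - 1 = p - 2 + 1 by ring, Real.rpow_add_one (abs_pos.2 hs).ne']

lemma mul_phip {p : ℝ} (hp : p ≠ 0) (s : ℝ) : s * phip p s = |s| ^ p := by
  rcases eq_or_ne s 0 with rfl | hs
  · simp [Real.zero_rpow hp]
  · have h : |s| ^ p = |s| ^ (p - 2) * (|s| * |s|) := by
      rw [← mul_assoc, ← Real.rpow_add_one (abs_pos.2 hs).ne',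
        ← Real.rpow_add_one (abs_pos.2 hs).ne']
      ring_nf
    rw [h, abs_mul_abs_self, phip]
    ring

lemma phip_mul_of_pos {r : ℝ} (p : ℝ) (hr : 0 < r) (s : ℝ) :
    phip p (r * s) = r ^ (p - 1) * phip p s := by
  rw [← phip_of_pos p hr, phip, phip, phip, abs_mul,
    Real.mul_rpow (abs_nonneg r) (abs_nonneg s)]
  ring

/-- Young's inequality in the form behind Picone's identity. -/
lemma mul_mul_phip_le {p : ℝ} (hp : 1 < p) (w t : ℝ) :
    p * (w * phip p t) ≤ |w| ^ p + (p - 1) * |t| ^ p := by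
  have hp0 : 0 < p := by linarith
  rcases eq_or_ne t 0 with rfl | ht
  · simp only [phip, mul_zero, abs_zero, Real.zero_rpow hp0.ne', add_zero]
    positivity
  have hpq := Real.HolderConjugate.conjExponent hp
  have hy := Real.young_inequality_of_nonneg (abs_nonneg w)
    (Real.rpow_nonneg (abs_nonneg t) (p - 1)) hpq
  have hq : (p - 1) * p.conjExponent = p := by
    rw [Real.conjExponent]
    field_simp [(sub_pos.2 hp).ne']
  rw [← Real.rpow_mul (abs_nonneg t), hq] at hy
  have h1 : w * phip p t ≤ |w| * |t| ^ (p - 1) := by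
    rw [← abs_phip p ht, ← abs_mul]
    exact le_abs_self _
  have h2 : p * (|w| ^ p / p + |t| ^ p / p.conjExponent) = |w| ^ p + (p - 1) * |t| ^ p := by
    rw [Real.conjExponent]
    field_simp [(sub_pos.2 hp).ne']
  rw [← h2]
  exact mul_le_mul_of_nonneg_left (h1.trans hy) hp0.le

lemma tendsto_rpow_mul_rpow_one_sub {p : ℝ} (hp : 1 < p) {u v : ℝ → ℝ} {u' v' x₀ : ℝ}
    {s : Set ℝ} (hs : x₀ ∉ s) (hu : HasDerivAt u u' x₀) (hv : HasDerivAt v v' x₀)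
    (hsimple : u x₀ = 0 → u' ≠ 0) (hv0 : v x₀ = 0)
    (hupos : ∀ x ∈ s, 0 < u x) (hvpos : ∀ x ∈ s, 0 < v x) :
    Tendsto (fun x => v x ^ p * u x ^ (1 - p)) (𝓝[s] x₀) (𝓝 0) := by
  obtain ⟨L, hL⟩ : ∃ L, Tendsto (fun x => v x / u x) (𝓝[s] x₀) (𝓝 L) := by
    by_cases hu0 : u x₀ = 0
    · have hle : 𝓝[s] x₀ ≤ 𝓝[≠] x₀ :=
        nhdsWithin_mono _ fun x hx hxx => hs (hxx ▸ hx)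
      have hsu := (hasDerivAt_iff_tendsto_slope.1 hu).mono_left hle
      have hsv := (hasDerivAt_iff_tendsto_slope.1 hv).mono_left hle
      refine ⟨v' / u', (hsv.div hsu (hsimple hu0)).congr' ?_⟩
      filter_upwards [self_mem_nhdsWithin] with x hx
      have hxx : x - x₀ ≠ 0 := sub_ne_zero.2 fun h => hs (h ▸ hx)
      have := (hupos x hx).ne'
      simp only [Pi.div_apply, slope_def_field, hu0, hv0, sub_zero]
      field_simp
    · exact ⟨_, (hv.continuousAt.tendsto.div hu.continuousAt.tendsto hu0).mono_left
        nhdsWithin_le_nhds⟩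
  have hvt : Tendsto v (𝓝[s] x₀) (𝓝 0) := by
    simpa [hv0] using hv.continuousAt.tendsto.mono_left nhdsWithin_le_nhds
  have hlim := hvt.mul (hL.rpow_const (p := p - 1) (Or.inr (by linarith)))
  rw [zero_mul] at hlim
  refine hlim.congr' ?_
  filter_upwards [self_mem_nhdsWithin] with x hx
  have h1 := hupos x hx
  have h2 := hvpos x hx
  rw [Real.div_rpow h2.le h1.le, show 1 - p = -(p - 1) by ring, Real.rpow_neg h1.le,
    div_eq_mul_inv, ← mul_assoc, mul_comm (v x), ← Real.rpow_add_one h2.ne']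
  ring_nf

/-- The derivative of Picone's function, computed at a point where `u, v > 0`. -/
lemma hasDerivAt_picone {p : ℝ} {u v u' v' : ℝ → ℝ} {x b c : ℝ}
    (hu : HasDerivAt u (u' x) x) (hv : HasDerivAt v (v' x) x)
    (hPu : HasDerivAt (fun y => phip p (u' y)) (-(b * phip p (u x))) x)
    (hPv : HasDerivAt (fun y => phip p (v' y)) (-(c * phip p (v x))) x)
    (hp : 1 < p) (hux : 0 < u x) (hvx : 0 < v x) :
    HasDerivAt (fun y => v y * phip p (v' y) - v y ^ p * u y ^ (1 - p) * phip p (u' y))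
      (|v' x| ^ p + (p - 1) * |v x / u x * u' x| ^ p
        - p * (v' x * phip p (v x / u x * u' x)) + (b - c) * v x ^ p) x := by
  have hr : 0 < v x / u x := div_pos hvx hux
  have hp0 : p ≠ 0 := by linarith
  refine ((hv.mul hPv).sub (((hv.rpow_const (p := p) (Or.inl hvx.ne')).mul
    (hu.rpow_const (p := 1 - p) (Or.inl hux.ne'))).mul hPu)).congr_deriv ?_
  rw [Pi.mul_apply, ← mul_phip hp0 (v x / u x * u' x), ← mul_phip hp0 (v' x), phip_mul_of_pos p hr,
    phip_of_pos p hux, phip_of_pos p hvx, Real.div_rpow hvx.le hux.le,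
    show 1 - p - 1 = -(p - 1) - 1 by ring, show 1 - p = -(p - 1) by ring,
    Real.rpow_sub_one hux.ne', Real.rpow_neg hux.le,
    show v x ^ p = v x ^ (p - 1) * v x by rw [← Real.rpow_add_one hvx.ne']; ring_nf]
  have := (Real.rpow_pos_of_pos hux (p - 1)).ne'
  field_simp
  ring

lemma sturm_picone_of_pos {p : ℝ} (hp : 1 < p) {u v u' v' b c : ℝ → ℝ} {α β : ℝ} (hαβ : α < β)
    (hu : ∀ x, HasDerivAt u (u' x) x) (hv : ∀ x, HasDerivAt v (v' x) x)
    (hu' : Continuous fun y => phip p (u' y)) (hv' : Continuous fun y => phip p (v' y))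
    (hPu : ∀ x ∈ Ioo α β, HasDerivAt (fun y => phip p (u' y)) (-(b x * phip p (u x))) x)
    (hPv : ∀ x ∈ Ioo α β, HasDerivAt (fun y => phip p (v' y)) (-(c x * phip p (v x))) x)
    (hbc : ∀ x ∈ Ioo α β, c x < b x)
    (hsα : u α = 0 → u' α ≠ 0) (hsβ : u β = 0 → u' β ≠ 0) (hvα : v α = 0) (hvβ : v β = 0)
    (hupos : ∀ x ∈ Ioo α β, 0 < u x) (hvpos : ∀ x ∈ Ioo α β, 0 < v x) : False := by
  have hp0 : p ≠ 0 := by linarith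
  set W : ℝ → ℝ := fun y => v y * phip p (v' y) - v y ^ p * u y ^ (1 - p) * phip p (u' y)
  have hW0 : ∀ x, v x = 0 → W x = 0 := fun x hx => by
    simp [W, hx, Real.zero_rpow hp0]
  have hend : ∀ x₀, x₀ ∉ Ioo α β → (u x₀ = 0 → u' x₀ ≠ 0) → v x₀ = 0 →
      Tendsto W (𝓝[Ioo α β] x₀) (𝓝 0) := fun x₀ hx₀ hs h0 => by
    have h1 := tendsto_rpow_mul_rpow_one_sub hp hx₀ (hu x₀) (hv x₀) hs h0 hupos hvpos
    have h2 := ((hv x₀).continuousAt.mul hv'.continuousAt).tendsto.mono_left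
      (nhdsWithin_le_nhds (s := Ioo α β))
    simpa [h0] using h2.sub (h1.mul (hu'.continuousAt.tendsto.mono_left nhdsWithin_le_nhds))
  have hder := fun x (hx : x ∈ Ioo α β) => hasDerivAt_picone (hu x) (hv x) (hPu x hx) (hPv x hx)
    hp (hupos x hx) (hvpos x hx)
  have hcont : ContinuousOn W (Icc α β) := by
    refine (continuousOn_Icc_extendFrom_Ioo (f := W) (la := 0) (lb := 0)
      (fun x hx => (hder x hx).continuousAt.continuousWithinAt) ?_ ?_).congr ?_
    · rw [← nhdsWithin_Ioo_eq_nhdsGT hαβ]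
      exact hend α (by simp) hsα hvα
    · rw [← nhdsWithin_Ioo_eq_nhdsLT hαβ]
      exact hend β (by simp) hsβ hvβ
    · intro x hx
      rcases eq_or_ne x α with rfl | hxα
      · rw [hW0 x hvα, eq_lim_at_left_extendFrom_Ioo hαβ]
        rw [← nhdsWithin_Ioo_eq_nhdsGT hαβ]
        exact hend x (by simp) hsα hvα
      rcases eq_or_ne x β with rfl | hxβ
      · rw [hW0 x hvβ, eq_lim_at_right_extendFrom_Ioo hαβ]
        rw [← nhdsWithin_Ioo_eq_nhdsLT hαβ]
        exact hend x (by simp) hsβ hvβ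
      have hx' : x ∈ Ioo α β := ⟨lt_of_le_of_ne hx.1 hxα.symm, lt_of_le_of_ne hx.2 hxβ⟩
      refine (extendFrom_eq (by rw [closure_Ioo hαβ.ne]; exact hx) ?_).symm
      exact (hder x hx').continuousAt.continuousWithinAt
  have hmono : StrictMonoOn W (Icc α β) := by
    refine strictMonoOn_of_deriv_pos (convex_Icc α β) hcont fun x hx => ?_
    rw [interior_Icc] at hx
    rw [(hder x hx).deriv]
    have h1 := mul_mul_phip_le hp (v' x) (v x / u x * u' x)
    have h2 := mul_pos (sub_pos.2 (hbc x hx)) (Real.rpow_pos_of_pos (hvpos x hx) p)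
    linarith
  have := hmono (left_mem_Icc.2 hαβ.le) (right_mem_Icc.2 hαβ.le) hαβ
  rw [hW0 α hvα, hW0 β hvβ] at this
  exact this.false

lemma continuous_phip {p : ℝ} (hp : 1 < p) : Continuous (phip p) := by
  refine continuous_iff_continuousAt.2 fun s => ?_
  rcases eq_or_ne s 0 with rfl | hs
  · have h : Tendsto (fun t : ℝ => |t| ^ (p - 1)) (𝓝 0) (𝓝 0) := by
      have := (continuous_abs.tendsto (0 : ℝ)).rpow_const (p := p - 1) (Or.inr (by linarith))
      rwa [abs_zero, Real.zero_rpow (by linarith)] at this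
    rw [ContinuousAt, show phip p 0 = 0 by simp [phip]]
    refine squeeze_zero_norm (fun t => ?_) h
    rcases eq_or_ne t 0 with rfl | ht
    · simp [phip, Real.zero_rpow (show p - 1 ≠ 0 by linarith)]
    · exact (abs_phip p ht).le
  · exact (continuous_abs.continuousAt.rpow_const (Or.inl (abs_pos.2 hs).ne')).mul continuousAt_id

lemma pos_or_neg_of_ne_zero {u : ℝ → ℝ} (hu : Continuous u) {α β : ℝ}
    (h : ∀ x ∈ Ioo α β, u x ≠ 0) :
    (∀ x ∈ Ioo α β, 0 < u x) ∨ ∀ x ∈ Ioo α β, u x < 0 := by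
  by_contra! hcon
  obtain ⟨⟨x, hx, hxu⟩, y, hy, hyu⟩ := hcon
  obtain ⟨z, hz, hz0⟩ := isPreconnected_Ioo.intermediate_value hx hy hu.continuousOn ⟨hxu, hyu⟩
  exact h z hz hz0

/-- **Sturm's comparison theorem** for the one-dimensional `p`-Laplacian: `u` vanishes between
consecutive zeros of `v`. -/
lemma exists_zero_of_sturm {p : ℝ} (hp : 1 < p) {u v b c : ℝ → ℝ} {α β : ℝ} (hαβ : α < β)
    (hu : ContDiff ℝ 1 u) (hv : ContDiff ℝ 1 v)
    (hPu : ∀ x ∈ Ioo α β, u x ≠ 0 →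
      HasDerivAt (fun y => phip p (deriv u y)) (-(b x * phip p (u x))) x)
    (hPv : ∀ x ∈ Ioo α β, v x ≠ 0 →
      HasDerivAt (fun y => phip p (deriv v y)) (-(c x * phip p (v x))) x)
    (hbc : ∀ x ∈ Ioo α β, u x ≠ 0 → v x ≠ 0 → c x < b x)
    (hsimple : ∀ x ∈ Icc α β, u x = 0 → deriv u x ≠ 0)
    (hvα : v α = 0) (hvβ : v β = 0) (hv0 : ∀ x ∈ Ioo α β, v x ≠ 0) :
    ∃ x ∈ Ioo α β, u x = 0 := by
  by_contra! hu0
  have hdu : ∀ x, HasDerivAt u (deriv u x) x := fun x =>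
    (hu.differentiable one_ne_zero x).hasDerivAt
  have hdv : ∀ x, HasDerivAt v (deriv v x) x := fun x =>
    (hv.differentiable one_ne_zero x).hasDerivAt
  have hcu := (continuous_phip hp).comp (hu.continuous_deriv le_rfl)
  have hcv := (continuous_phip hp).comp (hv.continuous_deriv le_rfl)
  have hPu' := fun x hx => hPu x hx (hu0 x hx)
  have hPv' := fun x hx => hPv x hx (hv0 x hx)
  have hbc' := fun x hx => hbc x hx (hu0 x hx) (hv0 x hx)
  have hsα := hsimple α (left_mem_Icc.2 hαβ.le)
  have hsβ := hsimple β (right_mem_Icc.2 hαβ.le)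
  have key : ∀ {w w' d : ℝ → ℝ},
      (∀ x ∈ Ioo α β, HasDerivAt (fun y => phip p (w' y)) (-(d x * phip p (w x))) x) →
      ∀ x ∈ Ioo α β, HasDerivAt (fun y => phip p (-w' y)) (-(d x * phip p (-w x))) x := by
    intro w w' d h x hx
    simpa only [phip_neg, mul_neg] using (h x hx).fun_neg
  have hcu' : Continuous fun y => phip p (-deriv u y) := by
    simpa only [phip_neg, Function.comp_apply] using hcu.fun_neg
  have hcv' : Continuous fun y => phip p (-deriv v y) := by
    simpa only [phip_neg, Function.comp_apply] using hcv.fun_neg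
  rcases pos_or_neg_of_ne_zero hu.continuous hu0 with hup | hun <;>
    rcases pos_or_neg_of_ne_zero hv.continuous hv0 with hvp | hvn
  · exact sturm_picone_of_pos hp hαβ hdu hdv hcu hcv hPu' hPv' hbc' hsα hsβ hvα hvβ hup hvp
  · exact sturm_picone_of_pos hp hαβ hdu (fun x => (hdv x).fun_neg) hcu hcv' hPu' (key hPv') hbc'
      hsα hsβ (by simpa using hvα) (by simpa using hvβ) hup (fun x hx => neg_pos.2 (hvn x hx))
  · exact sturm_picone_of_pos hp hαβ (fun x => (hdu x).fun_neg) hdv hcu' hcv (key hPu') hPv' hbc'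
      (by simpa using hsα) (by simpa using hsβ) hvα hvβ (fun x hx => neg_pos.2 (hun x hx)) hvp
  · exact sturm_picone_of_pos hp hαβ (fun x => (hdu x).fun_neg) (fun x => (hdv x).fun_neg)
      hcu' hcv' (key hPu') (key hPv') hbc' (by simpa using hsα) (by simpa using hsβ)
      (by simpa using hvα) (by simpa using hvβ)
      (fun x hx => neg_pos.2 (hun x hx)) (fun x hx => neg_pos.2 (hvn x hx))

/-- If `u` vanishes strictly between any two consecutive zeros of `v`, it has at least one more
interior zero than `v`. -/
lemma ncard_zeros_lt {u v : ℝ → ℝ} (hv0 : v 0 = 0) (hv1 : v 1 = 0)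
    (hfu : {x ∈ Ioo (0:ℝ) 1 | u x = 0}.Finite) (hfv : {x ∈ Ioo (0:ℝ) 1 | v x = 0}.Finite)
    (h : ∀ α ∈ Icc (0:ℝ) 1, ∀ β ∈ Icc (0:ℝ) 1, α < β → v α = 0 → v β = 0 →
      (∀ x ∈ Ioo α β, v x ≠ 0) → ∃ x ∈ Ioo α β, u x = 0) :
    {x ∈ Ioo (0:ℝ) 1 | v x = 0}.ncard < {x ∈ Ioo (0:ℝ) 1 | u x = 0}.ncard := by
  set Z := {x ∈ Ioo (0:ℝ) 1 | v x = 0} with hZ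
  have hnext : ∀ z ∈ insert 0 Z, ∃ ζ ∈ {x ∈ Ioo (0:ℝ) 1 | u x = 0}, z < ζ ∧
      ∀ w ∈ Z, z < w → ζ < w := by
    intro z hz
    have hz' : 0 ≤ z ∧ z < 1 ∧ v z = 0 := by
      rcases hz with rfl | hz
      · exact ⟨le_rfl, one_pos, hv0⟩
      · exact ⟨hz.1.1.le, hz.1.2, hz.2⟩
    obtain ⟨β, ⟨hβ, hzβ⟩, hmin⟩ := ((hfv.insert 1).subset
      (sep_subset (insert 1 Z) (fun w => z < w))).exists_minimal ⟨1, mem_insert _ _, hz'.2.1⟩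
    have hβ' : β ≤ 1 ∧ v β = 0 := by
      rcases hβ with rfl | hβ
      · exact ⟨le_rfl, hv1⟩
      · exact ⟨hβ.1.2.le, hβ.2⟩
    have hle : ∀ w ∈ Z, z < w → β ≤ w := fun w hw hzw => by
      by_contra! hlt
      exact hlt.not_ge (hmin ⟨mem_insert_of_mem _ hw, hzw⟩ hlt.le)
    obtain ⟨ζ, hζ, hζ0⟩ := h z ⟨hz'.1, hz'.2.1.le⟩ β ⟨hz'.1.trans hzβ.le, hβ'.1⟩ hzβ hz'.2.2
      hβ'.2 fun x hx hx0 =>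
        (hle x ⟨⟨hz'.1.trans_lt hx.1, hx.2.trans_le hβ'.1⟩, hx0⟩ hx.1).not_gt hx.2
    exact ⟨ζ, ⟨⟨hz'.1.trans_lt hζ.1, hζ.2.trans_le hβ'.1⟩, hζ0⟩, hζ.1,
      fun w hw hzw => hζ.2.trans_le (hle w hw hzw)⟩
  choose! F hF hlt hF' using hnext
  have hinj : InjOn F (insert 0 Z) := by
    refine StrictMonoOn.injOn fun z hz w hw hzw => ?_
    have hwZ : w ∈ Z := by
      rcases hw with rfl | hw
      · rcases hz with rfl | hz
        · exact absurd hzw (lt_irrefl _)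
        · exact absurd hzw hz.1.1.not_gt
      · exact hw
    exact (hF' z hz w hwZ hzw).trans (hlt w hw)
  have hcard := ncard_le_ncard_of_injOn F hF hinj hfu
  rw [ncard_insert_of_notMem (fun h0 => h0.1.1.false) hfv] at hcard
  exact hcard

lemma abs_le_normE {u : ℝ → ℝ} (hu : ContDiff ℝ 1 u) {x : ℝ} (hx : x ∈ Icc (0:ℝ) 1) :
    |u x| ≤ normE u := by
  have hb : BddAbove (range fun x : Icc (0:ℝ) 1 => |u x|) :=
    (isCompact_range (by have := hu.continuous; fun_prop)).bddAbove
  exact (le_ciSup hb ⟨x, hx⟩).trans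
    (le_add_of_nonneg_right (Real.iSup_nonneg fun _ => abs_nonneg _))

/-- Composing with the perturbation `s ↦ s|s|^ε` preserves the growth bound `M|s|^{p-1}`
for small `s`. -/
lemma abs_le_of_perturbation {p M ε : ℝ} (hp : 1 < p) (hM : 0 ≤ M) (hε : 0 ≤ ε) {F : ℝ → ℝ}
    (hF : ∀ s : ℝ, 0 < |s| → |s| ≤ 1 → |F s| ≤ M * |phip p s|) {s : ℝ} (hs : s ≠ 0)
    (hs1 : |s| ≤ 1) : |F (s * |s| ^ ε)| ≤ M * |s| ^ (p - 1) := by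
  have hs0 := abs_pos.2 hs
  have hε0 : 0 < |s| ^ ε := Real.rpow_pos_of_pos hs0 ε
  have habs : |s * |s| ^ ε| = |s| * |s| ^ ε := by rw [abs_mul, abs_of_pos hε0]
  have hle : |s| * |s| ^ ε ≤ |s| :=
    mul_le_of_le_one_right hs0.le (Real.rpow_le_one hs0.le hs1 hε)
  have hne : s * |s| ^ ε ≠ 0 := mul_ne_zero hs hε0.ne'
  refine (hF _ (abs_pos.2 hne) (by rw [habs]; exact hle.trans hs1)).trans ?_
  rw [abs_phip p hne, habs]
  gcongr

/-- **Lemma 2.3**: a priori bound on the bifurcation parameter: if nontrivial solutions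
`(λ_n, u_n) ∈ ℝ × S_k^ν` of the approximate problems (with ε_n → 0) converge to `(λ, 0)`
in `ℝ × E`, then `λ ∈ I_k = [λ_k - M/a_0, λ_k + M/a_0]`. -/
theorem stmt5 (p : ℝ) (hp : 1 < p)
    (a : ℝ → ℝ) (ha : ContinuousOn a (Icc 0 1)) (hapos : ∀ x ∈ Icc (0:ℝ) 1, 0 < a x)
    (f g : ℝ → ℝ → ℝ → ℝ)
    (hf : ContinuousOn (fun q : ℝ × ℝ × ℝ => f q.1 q.2.1 q.2.2)
      (Ioo (0:ℝ) 1 ×ˢ (univ : Set (ℝ × ℝ))))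
    (hg : ContinuousOn (fun q : ℝ × ℝ × ℝ => g q.1 q.2.1 q.2.2)
      (Ioo (0:ℝ) 1 ×ˢ (univ : Set (ℝ × ℝ))))
    (M : ℝ) (hM : 0 < M)
    -- (C1)
    (hC1 : ∀ x ∈ Ioo (0:ℝ) 1, ∀ s : ℝ, 0 < |s| → |s| ≤ 1 → ∀ lam : ℝ,
      |f x s lam| ≤ M * |phip p s|)
    -- (C2)
    (hC2 : ∀ C > (0:ℝ), ∀ ε > (0:ℝ), ∃ δ > (0:ℝ), ∀ x ∈ Ioo (0:ℝ) 1, ∀ s : ℝ,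
      0 < |s| → |s| < δ → ∀ lam : ℝ, |lam| ≤ C → |g x s lam| ≤ ε * |s| ^ (p - 1))
    -- a0 = min a on [0,1]
    (a0 : ℝ) (ha0 : IsLeast (a '' Icc 0 1) a0)
    (k : ℕ) (hk : 1 ≤ k) (ν : ℝ) (hν : ν = 1 ∨ ν = -1)
    -- λ_k : the k-th eigenvalue of the linear problem
    (lamk : ℝ) (hlamk : ∃ u, IsLinSol p a lamk u ∧ MemS k 1 u)
    -- the sequence ε_n ∈ [0,1], ε_n → 0
    (εn : ℕ → ℝ) (hεn : ∀ n, εn n ∈ Icc (0:ℝ) 1)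
    (hεn0 : Tendsto εn atTop (𝓝 0))
    -- the nontrivial solutions (λ_n, u_n) ∈ ℝ × S_k^ν
    (lamn : ℕ → ℝ) (un : ℕ → ℝ → ℝ)
    (hsol : ∀ n, IsSolEps p a f g (εn n) (lamn n) (un n) ∧ MemS k ν (un n) ∧ Nontriv (un n))
    -- (λ_n, u_n) → (λ, 0) in ℝ × E
    (lam : ℝ) (hlamn : Tendsto lamn atTop (𝓝 lam))
    (hun : Tendsto (fun n => normE (un n)) atTop (𝓝 0)) :
    lam ∈ Icc (lamk - M / a0) (lamk + M / a0) := by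
  obtain ⟨⟨x₀, hx₀, hax₀⟩, ha0le⟩ := ha0
  have ha0pos : 0 < a0 := hax₀ ▸ hapos x₀ hx₀
  have ha0le' : ∀ x ∈ Ioo (0:ℝ) 1, a0 ≤ a x := fun x hx =>
    ha0le (mem_image_of_mem a (Ioo_subset_Icc_self hx))
  obtain ⟨v, ⟨⟨hvC, hv0, hv1⟩, hveq⟩, -, hvfin, hvcard, hvs, -⟩ := hlamk
  set B : ℕ → ℝ → ℝ := fun n x => lamn n * a x +
    (f x (un n x * |un n x| ^ εn n) (lamn n) + g x (un n x) (lamn n)) / phip p (un n x)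
  have hphi : ∀ s : ℝ, s ≠ 0 → phip p s ≠ 0 := fun s hs => by
    rw [← abs_pos, abs_phip p hs]
    exact Real.rpow_pos_of_pos (abs_pos.2 hs) _
  have hBeq : ∀ n, ∀ x ∈ Ioo (0:ℝ) 1, un n x ≠ 0 →
      HasDerivAt (fun y => phip p (deriv (un n) y)) (-(B n x * phip p (un n x))) x := by
    intro n x hx hux
    refine ((hsol n).1.2 x hx).congr_deriv ?_
    have := hphi _ hux
    simp only [B]
    field_simp
    ring
  have hB : ∀ η > 0, ∀ᶠ n in atTop, ∀ x ∈ Ioo (0:ℝ) 1, un n x ≠ 0 →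
      |B n x - lamn n * a x| ≤ M + η := by
    intro η hη
    obtain ⟨δ, hδ, hgδ⟩ := hC2 (|lam| + 1) (by positivity) η hη
    filter_upwards [hun.eventually_lt_const (lt_min hδ one_pos),
      hlamn.abs.eventually_le_const (lt_add_one |lam|)] with n hn hl x hx hux
    have hsmall : |un n x| < min δ 1 :=
      (abs_le_normE (hsol n).1.1.1 (Ioo_subset_Icc_self hx)).trans_lt hn
    have h1 := abs_le_of_perturbation hp hM.le (hεn n).1
      (F := fun s => f x s (lamn n)) (fun s hs hs1 => hC1 x hx s hs hs1 _) hux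
      (hsmall.trans_le (min_le_right _ _)).le
    have h2 := hgδ x hx _ (abs_pos.2 hux) (hsmall.trans_le (min_le_left _ _)) _ hl
    simp only [B, add_sub_cancel_left]
    rw [abs_div, abs_phip p hux, div_le_iff₀ (Real.rpow_pos_of_pos (abs_pos.2 hux) _), add_mul]
    exact (abs_add_le _ _).trans (add_le_add h1 h2)
  refine ⟨?_, ?_⟩
  · by_contra! hlt
    have hgap : M < (lamk - lam) * a0 := by
      rw [← div_lt_iff₀ ha0pos]; linarith
    obtain ⟨m, hm, hm'⟩ := exists_between hgap
    obtain ⟨n, hn, hln⟩ := ((hB (m - M) (sub_pos.2 hm)).and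
      (((tendsto_const_nhds.sub hlamn).mul_const a0).eventually_const_lt hm')).exists
    obtain ⟨⟨⟨huC, hu0, hu1⟩, -⟩, ⟨-, hufin, hucard, hus, -⟩, -⟩ := hsol n
    have hcount := ncard_zeros_lt hu0 hu1 hvfin hufin
      fun α hα β hβ hαβ hα0 hβ0 hne => by
        have hsub : Ioo α β ⊆ Ioo 0 1 := Ioo_subset_Ioo hα.1 hβ.2
        refine exists_zero_of_sturm hp hαβ hvC huC (b := fun x => lamk * a x) (c := B n)
          (fun x hx _ => hveq x (hsub hx)) (fun x hx => hBeq n x (hsub hx)) ?_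
          (fun x hx => hvs x ⟨hα.1.trans hx.1, hx.2.trans hβ.2⟩) hα0 hβ0 hne
        intro x hx _ hux
        have h1 := (abs_le.1 (hn x (hsub hx) hux)).2
        have h2 : 0 < lamk - lamn n := pos_of_mul_pos_left ((hM.trans hm).trans hln) ha0pos.le
        have h3 := mul_le_mul_of_nonneg_left (ha0le' x (hsub hx)) h2.le
        linarith
    rw [hvcard, hucard] at hcount
    exact hcount.false
  · by_contra! hlt
    have hgap : M < (lam - lamk) * a0 := by
      rw [← div_lt_iff₀ ha0pos]; linarith
    obtain ⟨m, hm, hm'⟩ := exists_between hgap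
    obtain ⟨n, hn, hln⟩ := ((hB (m - M) (sub_pos.2 hm)).and
      (((hlamn.sub_const lamk).mul_const a0).eventually_const_lt hm')).exists
    obtain ⟨⟨⟨huC, -, -⟩, -⟩, ⟨-, hufin, hucard, hus, -⟩, -⟩ := hsol n
    have hcount := ncard_zeros_lt hv0 hv1 hufin hvfin
      fun α hα β hβ hαβ hα0 hβ0 hne => by
        have hsub : Ioo α β ⊆ Ioo 0 1 := Ioo_subset_Ioo hα.1 hβ.2
        refine exists_zero_of_sturm hp hαβ huC hvC (b := B n) (c := fun x => lamk * a x)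
          (fun x hx => hBeq n x (hsub hx)) (fun x hx _ => hveq x (hsub hx)) ?_
          (fun x hx => hus x ⟨hα.1.trans hx.1, hx.2.trans hβ.2⟩) hα0 hβ0 hne
        intro x hx hux _
        have h1 := (abs_le.1 (hn x (hsub hx) hux)).1
        have h2 : 0 < lamn n - lamk := pos_of_mul_pos_left ((hM.trans hm).trans hln) ha0pos.le
        have h3 := mul_le_mul_of_nonneg_left (ha0le' x (hsub hx)) h2.le
        linarith
    rw [hvcard, hucard] at hcount
    exact hcount.false
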